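/- arXiv:2604.01938 — 6 statements merged into one kernel-verified Lean document; each statement's English description precedes it below -/
import Mathlib

section
/- For every arrangement p on the order-3 permutohedron, setting Z = π 1 * π 6 + π 2 * π 5 + π 3 * π 4, the following hold: 2*Z ≤ P_p(1) ≤ min(2*S(p), 1 - S(p)) ≤ 2/3, 2*Z ≤ P_p(2) ≤ min(2*S(p), 1 - S(p)) ≤ 2/3, and Z ≤ P_p(3) ≤ min(S(p), 1 - S(p)) ≤ 1/2. -/
noncomputable section
open scoped Classical

/-- swap distance on the order-3 permutohedron (the 6-cycle on `Fin 6`) -/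
def dd (i j : Fin 6) : ℕ := min ((i.val + 6 - j.val) % 6) ((j.val + 6 - i.val) % 6)

/-- average swap distance -/
def avgd (p : Fin 6 → ℝ) : ℝ := ∑ i, ∑ j, p i * p j * (dd i j : ℝ)

/-- Simpson index -/
def Simpson (p : Fin 6 → ℝ) : ℝ := ∑ i, (p i) ^ 2

/-- probability mass of swap distance `c` -/
def Pd (p : Fin 6 → ℝ) (c : ℕ) : ℝ := ∑ i, ∑ j, if dd i j = c then p i * p j else 0

theorem sum_mul_rev_le_sum_mul_comp_perm {n : ℕ} {p q : Fin n → ℝ} (hq : Antitone q)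
    (e : Equiv.Perm (Fin n)) (hqp : ∀ i, q i = p (e i)) (σ : Equiv.Perm (Fin n)) :
    ∑ i, q i * q i.rev ≤ ∑ i, p i * p (σ i) := by
  have hanti : Antivary q (q ∘ Fin.rev) :=
    hq.antivary fun _ _ h => hq (Fin.rev_le_rev.2 h)
  have h := hanti.sum_mul_le_sum_mul_comp_perm
    (σ := (e.trans (σ.trans e.symm)).trans Fin.revPerm)
  calc ∑ i, q i * q i.rev ≤ ∑ i, q i * q (e.symm (σ (e i))) := by simpa using h
    _ = ∑ i, p (e i) * p (σ (e i)) := by simp [hqp]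
    _ = ∑ i, p i * p (σ i) := Equiv.sum_comp e fun i => p i * p (σ i)

theorem sum_mul_comp_perm_le_sum_sq {ι : Type*} [Fintype ι] (p : ι → ℝ) (σ : Equiv.Perm ι) :
    ∑ i, p i * p (σ i) ≤ ∑ i, p i ^ 2 := by
  have h : ∑ i, p (σ i) ^ 2 = ∑ i, p i ^ 2 := Equiv.sum_comp σ fun i => p i ^ 2
  have h2 : ∑ i, 2 * (p i * p (σ i)) ≤ ∑ i, (p i ^ 2 + p (σ i) ^ 2) :=
    Finset.sum_le_sum fun i _ => by nlinarith [sq_nonneg (p i - p (σ i))]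
  rw [← Finset.mul_sum, Finset.sum_add_distrib, h] at h2
  linarith

theorem Pd_one (p : Fin 6 → ℝ) : Pd p 1 = 2 * ∑ i, p i * p (Equiv.addRight 1 i) := by
  simp [Pd, dd, Fin.sum_univ_six]
  ring

theorem Pd_two (p : Fin 6 → ℝ) : Pd p 2 = 2 * ∑ i, p i * p (Equiv.addRight 2 i) := by
  simp [Pd, dd, Fin.sum_univ_six]
  ring

theorem Pd_three (p : Fin 6 → ℝ) : Pd p 3 = ∑ i, p i * p (Equiv.addRight 3 i) := by
  simp [Pd, dd, Fin.sum_univ_six]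

theorem Simpson_add_Pd (p : Fin 6 → ℝ) :
    Simpson p + Pd p 1 + Pd p 2 + Pd p 3 = (∑ i, p i) ^ 2 := by
  rw [Pd_one, Pd_two, Pd_three]
  simp [Simpson, Fin.sum_univ_six]
  ring

theorem Pd_nonneg {p : Fin 6 → ℝ} (hp : ∀ i, 0 ≤ p i) (c : ℕ) : 0 ≤ Pd p c :=
  Finset.sum_nonneg fun i _ => Finset.sum_nonneg fun j _ => by
    split_ifs
    exacts [mul_nonneg (hp i) (hp j), le_rfl]

/-- bounds on `P_p(1)`, `P_p(2)`, `P_p(3)`. Here `pi` (0-indexed)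
enumerates the values of `p` in nonincreasing order, so `pi 0` is `π 1` of the
paper, …, `pi 5` is `π 6`, and `Z = π 1 π 6 + π 2 π 5 + π 3 π 4`. -/
theorem stmt_1 (p : Fin 6 → ℝ) (hp0 : ∀ i, 0 ≤ p i) (hp1 : ∑ i, p i = 1)
    (pi : Fin 6 → ℝ)
    (hpia : ∀ i j : Fin 6, i ≤ j → pi j ≤ pi i)
    (hpip : ∃ e : Equiv.Perm (Fin 6), ∀ i, pi i = p (e i)) :
    (2 * (pi 0 * pi 5 + pi 1 * pi 4 + pi 2 * pi 3) ≤ Pd p 1 ∧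
      Pd p 1 ≤ min (2 * Simpson p) (1 - Simpson p) ∧
      min (2 * Simpson p) (1 - Simpson p) ≤ 2 / 3) ∧
    (2 * (pi 0 * pi 5 + pi 1 * pi 4 + pi 2 * pi 3) ≤ Pd p 2 ∧
      Pd p 2 ≤ min (2 * Simpson p) (1 - Simpson p) ∧
      min (2 * Simpson p) (1 - Simpson p) ≤ 2 / 3) ∧
    ((pi 0 * pi 5 + pi 1 * pi 4 + pi 2 * pi 3) ≤ Pd p 3 ∧
      Pd p 3 ≤ min (Simpson p) (1 - Simpson p) ∧
      min (Simpson p) (1 - Simpson p) ≤ 1 / 2) := by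
  obtain ⟨e, he⟩ := hpip
  have hq : Antitone pi := fun i j => hpia i j
  have hpi0 (i) : 0 ≤ pi i := he i ▸ hp0 (e i)
  have hZ : ∑ i : Fin 6, pi i * pi i.rev
      = 2 * (pi 0 * pi 5 + pi 1 * pi 4 + pi 2 * pi 3) := by
    simp [Fin.sum_univ_six, Fin.rev]
    ring
  have hZ0 : 0 ≤ pi 0 * pi 5 + pi 1 * pi 4 + pi 2 * pi 3 :=
    add_nonneg (add_nonneg (mul_nonneg (hpi0 _) (hpi0 _)) (mul_nonneg (hpi0 _) (hpi0 _)))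
      (mul_nonneg (hpi0 _) (hpi0 _))
  have lower (σ) := sum_mul_rev_le_sum_mul_comp_perm hq e he σ
  rw [hZ] at lower
  have upper (σ : Equiv.Perm (Fin 6)) : ∑ i, p i * p (σ i) ≤ Simpson p := sum_mul_comp_perm_le_sum_sq p σ
  have htotal := Simpson_add_Pd p
  rw [hp1] at htotal
  have n1 := Pd_nonneg hp0 1
  have n2 := Pd_nonneg hp0 2
  have n3 := Pd_nonneg hp0 3
  have l1 := lower (Equiv.addRight 1)
  have l2 := lower (Equiv.addRight 2)
  have l3 := lower (Equiv.addRight 3)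
  have u1 := upper (Equiv.addRight 1)
  have u2 := upper (Equiv.addRight 2)
  have u3 := upper (Equiv.addRight 3)
  have e1 := Pd_one p
  have e2 := Pd_two p
  have e3 := Pd_three p
  have hmin : min (2 * Simpson p) (1 - Simpson p) ≤ 2 / 3 := by
    rw [min_le_iff]
    by_contra! h
    linarith
  have hmin' : min (Simpson p) (1 - Simpson p) ≤ 1 / 2 := by
    rw [min_le_iff]
    by_contra! h
    linarith
  refine ⟨⟨?_, le_min ?_ ?_, hmin⟩, ⟨?_, le_min ?_ ?_, hmin⟩, ?_, le_min ?_ ?_, hmin'⟩ <;>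
    linarith
end
end

section
/- For every arrangement p on the order-3 permutohedron: max(S̄(p), 2*S̄(p) - 2/3) ≤ ⟨d⟩(p) ≤ min(S̄(p) + 1, 2*S̄(p) + 1/2, 3/2). -/
noncomputable section
open scoped Classical

/-- Expansion of `avgd` along the three cuts of the hexagon into opposite half-cycles. -/
theorem avgd_eq_cuts (p : Fin 6 → ℝ) :
    avgd p = 2 * ((p 0 + p 1 + p 2) * (p 3 + p 4 + p 5)
      + (p 1 + p 2 + p 3) * (p 4 + p 5 + p 0)
      + (p 2 + p 3 + p 4) * (p 5 + p 0 + p 1)) := by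
  norm_num [avgd, dd, Fin.sum_univ_six]
  ring

/-- bounds on the average swap distance in terms of the
dominance index `S̄(p) = 1 - S(p)`. -/
theorem stmt_3 (p : Fin 6 → ℝ) (hp0 : ∀ i, 0 ≤ p i) (hp1 : ∑ i, p i = 1) :
    max (1 - Simpson p) (2 * (1 - Simpson p) - 2 / 3) ≤ avgd p ∧
    avgd p ≤ min (1 - Simpson p + 1) (min (2 * (1 - Simpson p) + 1 / 2) (3 / 2)) := by
  have hS : Simpson p = p 0 ^ 2 + p 1 ^ 2 + p 2 ^ 2 + p 3 ^ 2 + p 4 ^ 2 + p 5 ^ 2 := by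
    simp [Simpson, Fin.sum_univ_six]
  rw [Fin.sum_univ_six] at hp1
  have hsq : (p 0 + p 1 + p 2 + p 3 + p 4 + p 5) ^ 2 = 1 := by rw [hp1, one_pow]
  have h (i j : Fin 6) : 0 ≤ p i * p j := mul_nonneg (hp0 i) (hp0 j)
  rw [avgd_eq_cuts, hS]
  refine ⟨max_le ?_ ?_, le_min ?_ (le_min ?_ ?_)⟩
  · linarith [h 0 2, h 1 3, h 2 4, h 3 5, h 4 0, h 5 1, h 0 3, h 1 4, h 2 5]
  · linarith [h 0 2, h 1 3, h 2 4, h 3 5, h 4 0, h 5 1, h 0 3, h 1 4, h 2 5,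
      sq_nonneg (p 0 - p 1), sq_nonneg (p 1 - p 2), sq_nonneg (p 2 - p 3),
      sq_nonneg (p 3 - p 4), sq_nonneg (p 4 - p 5), sq_nonneg (p 5 - p 0)]
  · linarith [h 0 1, h 1 2, h 2 3, h 3 4, h 4 5, h 5 0,
      sq_nonneg (p 0 - p 3), sq_nonneg (p 1 - p 4), sq_nonneg (p 2 - p 5)]
  · linarith [h 0 1, h 1 2, h 2 3, h 3 4, h 4 5, h 5 0,
      h 0 2, h 1 3, h 2 4, h 3 5, h 4 0, h 5 1,
      sq_nonneg (p 0 - p 3), sq_nonneg (p 1 - p 4), sq_nonneg (p 2 - p 5)]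
  · linarith [sq_nonneg (p 0 + p 1 + p 2 - p 3 - p 4 - p 5),
      sq_nonneg (p 1 + p 2 + p 3 - p 4 - p 5 - p 0),
      sq_nonneg (p 2 + p 3 + p 4 - p 5 - p 0 - p 1)]
end
end

section
/- Let n ≥ 3, N = n!, d_max = n*(n-1)/2 and c = N/(N-1). Let p be a probability assignment on the permutohedron of order n supported on exactly two vertices σ0 ≠ τ0, with p σ0 = a and p τ0 = 1 - a for some 0 < a < 1, and let δ = d(σ0,τ0). Then: (i) ⟨d⟩(p) = 2*δ*a*(1-a); (ii) the minimum of ⟨d⟩(p ∘ g) over all bijections g of V equals 2*a*(1-a); (iii) the average of ⟨d⟩(p ∘ g) over all N! bijections g of V equals c*d_max*a*(1-a); (iv) consequently Ω(p) := (⟨d⟩_r - ⟨d⟩(p))/(⟨d⟩_r - ⟨d⟩_min) = (c*d_max - 2*δ)/(c*d_max - 2), which does not depend on a, and Ω(p) attains its minimum possible value ((c - 2)*d_max)/(c*d_max - 2) if and only if δ = d_max. -/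
noncomputable section
open scoped Classical

/-- Kendall tau (swap) distance between permutations of `Fin n`. -/
def kdist {n : ℕ} (σ τ : Equiv.Perm (Fin n)) : ℕ :=
  (Finset.univ.filter (fun ab : Fin n × Fin n =>
    ab.1 < ab.2 ∧ ¬((σ ab.1 < σ ab.2) ↔ (τ ab.1 < τ ab.2)))).card

/-- average swap distance on the permutohedron of order `n` -/
def avgP {n : ℕ} (p : Equiv.Perm (Fin n) → ℝ) : ℝ :=
  ∑ σ, ∑ τ, p σ * p τ * (kdist σ τ : ℝ)

/-- Simpson index -/
def SimpsonP {n : ℕ} (p : Equiv.Perm (Fin n) → ℝ) : ℝ := ∑ σ, (p σ) ^ 2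

theorem kdist_self {n : ℕ} (σ : Equiv.Perm (Fin n)) : kdist σ σ = 0 := by
  simp [kdist]

theorem kdist_comm {n : ℕ} (σ τ : Equiv.Perm (Fin n)) : kdist σ τ = kdist τ σ := by
  unfold kdist
  congr 1
  ext ab
  simp only [Finset.mem_filter, Finset.mem_univ, true_and]
  tauto

theorem kdist_pos {n : ℕ} {σ τ : Equiv.Perm (Fin n)} (h : σ ≠ τ) : 1 ≤ kdist σ τ := by
  by_contra! h0
  apply h
  have hempty : kdist σ τ = 0 := by omega
  unfold kdist at hempty
  rw [Finset.card_eq_zero, Finset.filter_eq_empty_iff] at hempty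
  have hlt : ∀ a b : Fin n, a < b → (σ a < σ b ↔ τ a < τ b) := by
    intro a b hab
    have := hempty (Finset.mem_univ (a, b))
    simp only [not_and, not_not] at this
    exact this hab
  have hiff : ∀ a b : Fin n, σ a < σ b ↔ τ a < τ b := by
    intro a b
    rcases lt_trichotomy a b with hab | rfl | hab
    · exact hlt a b hab
    · simp
    · have h1 := hlt b a hab
      have h2 : σ a ≠ σ b := fun e => hab.ne' (σ.injective e)
      have h3 : τ a ≠ τ b := fun e => hab.ne' (τ.injective e)
      grind
  have hmono : StrictMono (fun x => τ (σ.symm x)) := by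
    intro x y hxy
    exact (hiff _ _).1 (by simpa using hxy)
  let e : Fin n ≃o Fin n := StrictMono.orderIsoOfSurjective _ hmono
    (τ.surjective.comp σ.symm.surjective)
  have he : e = OrderIso.refl _ := Subsingleton.elim _ _
  ext x
  have : e (σ x) = σ x := by rw [he]; rfl
  have h2 : e (σ x) = τ x := by simp [e]
  rw [← this, h2]

theorem card_filter_fst_lt_snd (n : ℕ) :
    (Finset.univ.filter (fun ab : Fin n × Fin n => ab.1 < ab.2)).card = n * (n - 1) / 2 := by
  rw [Finset.card_filter, Fintype.sum_prod_type_right]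
  simp only [← Finset.card_filter]
  rw [← Finset.sum_range_id, ← Fin.sum_univ_eq_sum_range]
  refine Finset.sum_congr rfl fun b _ => ?_
  rw [← Fin.card_Iio b]
  congr 1
  ext; simp

theorem kdist_add_kdist_rev {n : ℕ} (σ τ : Equiv.Perm (Fin n)) :
    kdist σ τ + kdist σ (τ.trans Fin.revPerm) = n * (n - 1) / 2 := by
  rw [← card_filter_fst_lt_snd, ← Finset.card_filter_add_card_filter_not
    (s := Finset.univ.filter (fun ab : Fin n × Fin n => ab.1 < ab.2))
    (fun ab => ¬((σ ab.1 < σ ab.2) ↔ (τ ab.1 < τ ab.2))),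
    Finset.filter_filter, Finset.filter_filter]
  unfold kdist
  congr 2
  ext ⟨a, b⟩
  simp only [Finset.mem_filter, Finset.mem_univ, true_and, Equiv.trans_apply, Fin.revPerm_apply,
    Fin.rev_lt_rev]
  refine and_congr_right fun hab => ?_
  have h3 : τ a ≠ τ b := fun e => hab.ne (τ.injective e)
  grind

theorem two_mul_sum_kdist {n : ℕ} (σ : Equiv.Perm (Fin n)) :
    2 * ∑ τ, kdist σ τ = n.factorial * (n * (n - 1) / 2) := by
  have h : ∑ τ : Equiv.Perm (Fin n), kdist σ (τ.trans Fin.revPerm) = ∑ τ, kdist σ τ :=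
    Equiv.sum_comp (Equiv.mulLeft (Fin.revPerm : Equiv.Perm (Fin n))) (kdist σ)
  rw [two_mul]
  nth_rewrite 2 [← h]
  rw [← Finset.sum_add_distrib]
  simp [kdist_add_kdist_rev, Fintype.card_perm]

theorem exists_kdist_eq_one {n : ℕ} (hn : 2 ≤ n) :
    ∃ σ τ : Equiv.Perm (Fin n), σ ≠ τ ∧ kdist σ τ = 1 := by
  let i : Fin n := ⟨0, by omega⟩
  let j : Fin n := ⟨1, by omega⟩
  have hij : i ≠ j := by simp [i, j]
  refine ⟨1, Equiv.swap i j, fun h => hij ?_, ?_⟩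
  · have := congrArg (fun f => f j) h
    simpa using this.symm
  · unfold kdist
    rw [Finset.card_eq_one]
    refine ⟨(i, j), ?_⟩
    ext ⟨a, b⟩
    simp only [Finset.mem_filter, Finset.mem_univ, true_and, Finset.mem_singleton,
      Equiv.Perm.coe_one, id, Prod.mk.injEq, Equiv.swap_apply_def, i, j, Fin.ext_iff, Fin.lt_def]
    split_ifs <;> simp_all
    omega

theorem Equiv.Perm.exists_apply_eq_apply_eq {α : Type*} [DecidableEq α] {x y x' y' : α}
    (h : x ≠ y) (h' : x' ≠ y') : ∃ g : Equiv.Perm α, g x = x' ∧ g y = y' := by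
  refine ⟨(Equiv.swap x x').trans (Equiv.swap (Equiv.swap x x' y) y'), ?_, ?_⟩
  · rw [Equiv.trans_apply, Equiv.swap_apply_left, Equiv.swap_apply_of_ne_of_ne _ h']
    intro e
    apply h
    apply (Equiv.swap x x').injective
    rw [← e, Equiv.swap_apply_left]
  · simp

/-- The average of a function vanishing on the diagonal over the images of a fixed off-diagonal
pair under all permutations. -/
theorem sum_perm_apply_apply {α : Type*} [Fintype α] [DecidableEq α] (f : α → α → ℝ)
    (hf : ∀ x, f x x = 0) {x y : α} (hxy : x ≠ y) :
    (Fintype.card α : ℝ) * ((Fintype.card α : ℝ) - 1) * ∑ g : Equiv.Perm α, f (g x) (g y)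
      = (Fintype.card α).factorial * ∑ u, ∑ v, f u v := by
  have hconst : ∀ u v, u ≠ v →
      ∑ g : Equiv.Perm α, f (g u) (g v) = ∑ g : Equiv.Perm α, f (g x) (g y) := by
    intro u v huv
    obtain ⟨h, rfl, rfl⟩ := Equiv.Perm.exists_apply_eq_apply_eq hxy huv
    exact Equiv.sum_comp (Equiv.mulRight h) (fun g : Equiv.Perm α => f (g x) (g y))
  have hinv : ∀ g : Equiv.Perm α, ∑ u, ∑ v, f (g u) (g v) = ∑ u, ∑ v, f u v := by
    intro g
    rw [Equiv.sum_comp g (fun u => ∑ v, f u (g v))]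
    exact Finset.sum_congr rfl fun u _ => Equiv.sum_comp g (f u)
  have hsum : ∑ u, ∑ v, ∑ g : Equiv.Perm α, f (g u) (g v)
      = (Fintype.card α).factorial * ∑ u, ∑ v, f u v := by
    have : ∀ u, ∑ v, ∑ g : Equiv.Perm α, f (g u) (g v)
        = ∑ g : Equiv.Perm α, ∑ v, f (g u) (g v) := fun u => Finset.sum_comm
    simp only [this]
    rw [Finset.sum_comm]
    simp [hinv, Fintype.card_perm]
  rw [← hsum]
  have hrow : ∀ u, ∑ v, ∑ g : Equiv.Perm α, f (g u) (g v)
      = ((Fintype.card α : ℝ) - 1) * ∑ g : Equiv.Perm α, f (g x) (g y) := by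
    intro u
    rw [← Finset.add_sum_erase _ _ (Finset.mem_univ u),
      Finset.sum_congr rfl fun v hv => hconst u v (Finset.ne_of_mem_erase hv).symm]
    simp [hf, Finset.card_erase_of_mem, Nat.cast_sub (Fintype.card_pos_iff.2 ⟨u⟩)]
  simp only [hrow]
  simp [mul_assoc]

theorem avgP_two_point {n : ℕ} {σ τ : Equiv.Perm (Fin n)} (h : σ ≠ τ) (a b : ℝ)
    {p : Equiv.Perm (Fin n) → ℝ}
    (hp : ∀ x, p x = if x = σ then a else if x = τ then b else 0) :
    avgP p = 2 * (kdist σ τ : ℝ) * a * b := by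
  have hsplit : ∀ x, p x = (if x = σ then a else 0) + (if x = τ then b else 0) := by
    intro x
    rw [hp]
    split_ifs with h1 h2
    · exact absurd (h1.symm.trans h2) h
    all_goals simp
  unfold avgP
  simp only [hsplit, add_mul, mul_add, Finset.sum_add_distrib, ite_mul, mul_ite, zero_mul,
    mul_zero, Finset.sum_ite_eq', Finset.mem_univ, if_true, kdist_self,
    kdist_comm τ σ, Nat.cast_zero]
  simp
  ring

/-- arrangements supported on exactly two vertices.
`N = n!`, the number of bijections of `V` is `N! = (n!)!`,
`c = N/(N-1)`, `d_max = n(n-1)/2`, `δ = kdist σ0 τ0`.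
The random baseline `⟨d⟩_r` is written as the sum over all bijections
divided by `(n!)!`, and `⟨d⟩_min` as the infimum of the (finite, nonempty)
set of values `⟨d⟩(p ∘ g)`. -/
theorem stmt_5 (n : ℕ) (hn : 3 ≤ n)
    (σ0 τ0 : Equiv.Perm (Fin n)) (hne : σ0 ≠ τ0)
    (a : ℝ) (ha0 : 0 < a) (ha1 : a < 1)
    (p : Equiv.Perm (Fin n) → ℝ)
    (hp : p = fun σ => if σ = σ0 then a else if σ = τ0 then 1 - a else 0) :
    avgP p = 2 * (kdist σ0 τ0 : ℝ) * a * (1 - a) ∧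
    IsLeast {x : ℝ | ∃ g : Equiv.Perm (Equiv.Perm (Fin n)), x = avgP (p ∘ ⇑g)}
      (2 * a * (1 - a)) ∧
    (∑ g : Equiv.Perm (Equiv.Perm (Fin n)), avgP (p ∘ ⇑g)) /
        (Nat.factorial (Nat.factorial n) : ℝ)
      = ((Nat.factorial n : ℝ) / ((Nat.factorial n : ℝ) - 1))
          * ((n * (n - 1) / 2 : ℕ) : ℝ) * a * (1 - a) ∧
    ((∑ g : Equiv.Perm (Equiv.Perm (Fin n)), avgP (p ∘ ⇑g)) /
          (Nat.factorial (Nat.factorial n) : ℝ) - avgP p)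
        / ((∑ g : Equiv.Perm (Equiv.Perm (Fin n)), avgP (p ∘ ⇑g)) /
            (Nat.factorial (Nat.factorial n) : ℝ)
          - sInf {x : ℝ | ∃ g : Equiv.Perm (Equiv.Perm (Fin n)), x = avgP (p ∘ ⇑g)})
      = (((Nat.factorial n : ℝ) / ((Nat.factorial n : ℝ) - 1))
            * ((n * (n - 1) / 2 : ℕ) : ℝ) - 2 * (kdist σ0 τ0 : ℝ))
        / (((Nat.factorial n : ℝ) / ((Nat.factorial n : ℝ) - 1))
            * ((n * (n - 1) / 2 : ℕ) : ℝ) - 2) ∧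
    (((∑ g : Equiv.Perm (Equiv.Perm (Fin n)), avgP (p ∘ ⇑g)) /
          (Nat.factorial (Nat.factorial n) : ℝ) - avgP p)
        / ((∑ g : Equiv.Perm (Equiv.Perm (Fin n)), avgP (p ∘ ⇑g)) /
            (Nat.factorial (Nat.factorial n) : ℝ)
          - sInf {x : ℝ | ∃ g : Equiv.Perm (Equiv.Perm (Fin n)), x = avgP (p ∘ ⇑g)})
      = (((Nat.factorial n : ℝ) / ((Nat.factorial n : ℝ) - 1) - 2)
            * ((n * (n - 1) / 2 : ℕ) : ℝ))
        / (((Nat.factorial n : ℝ) / ((Nat.factorial n : ℝ) - 1))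
            * ((n * (n - 1) / 2 : ℕ) : ℝ) - 2)
      ↔ kdist σ0 τ0 = n * (n - 1) / 2) := by
  have hq : 0 < a * (1 - a) := mul_pos ha0 (by linarith)
  have havg : ∀ g : Equiv.Perm (Equiv.Perm (Fin n)),
      avgP (p ∘ ⇑g) = 2 * (kdist (g⁻¹ σ0) (g⁻¹ τ0) : ℝ) * a * (1 - a) := by
    intro g
    refine avgP_two_point (g⁻¹.injective.ne hne) _ _ fun x => ?_
    simp only [hp, Function.comp_apply, Equiv.Perm.eq_inv_iff_eq]
  have h1 : avgP p = 2 * (kdist σ0 τ0 : ℝ) * a * (1 - a) :=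
    avgP_two_point hne _ _ fun x => by rw [hp]
  have h2 : IsLeast {x : ℝ | ∃ g : Equiv.Perm (Equiv.Perm (Fin n)), x = avgP (p ∘ ⇑g)}
      (2 * a * (1 - a)) := by
    constructor
    · obtain ⟨σ, τ, hστ, hd⟩ := exists_kdist_eq_one (n := n) (by omega)
      obtain ⟨g, hg1, hg2⟩ := Equiv.Perm.exists_apply_eq_apply_eq hne hστ
      refine ⟨g⁻¹, ?_⟩
      rw [havg, inv_inv, hg1, hg2, hd]
      simp
    · rintro x ⟨g, rfl⟩
      rw [havg]
      have : (1 : ℝ) ≤ kdist (g⁻¹ σ0) (g⁻¹ τ0) := by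
        exact_mod_cast kdist_pos (g⁻¹.injective.ne hne)
      nlinarith
  have hN : (6 : ℝ) ≤ n.factorial := by
    exact_mod_cast Nat.factorial_le hn
  have hM : (3 : ℝ) ≤ ((n * (n - 1) / 2 : ℕ) : ℝ) := by
    have : 3 * 2 ≤ n * (n - 1) := Nat.mul_le_mul hn (by omega)
    exact_mod_cast (by omega : 3 ≤ n * (n - 1) / 2)
  have hF : (0 : ℝ) < n.factorial.factorial := by
    exact_mod_cast Nat.factorial_pos _
  have h3 : (∑ g : Equiv.Perm (Equiv.Perm (Fin n)), avgP (p ∘ ⇑g)) /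
        (Nat.factorial (Nat.factorial n) : ℝ)
      = ((Nat.factorial n : ℝ) / ((Nat.factorial n : ℝ) - 1))
          * ((n * (n - 1) / 2 : ℕ) : ℝ) * a * (1 - a) := by
    have hs : ∑ g : Equiv.Perm (Equiv.Perm (Fin n)), avgP (p ∘ ⇑g)
        = 2 * (a * (1 - a)) *
          ∑ g : Equiv.Perm (Equiv.Perm (Fin n)), (kdist (g σ0) (g τ0) : ℝ) := by
      rw [← Equiv.sum_comp (Equiv.inv (Equiv.Perm (Equiv.Perm (Fin n))))
        (fun g => (kdist (g σ0) (g τ0) : ℝ)), Finset.mul_sum]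
      refine Finset.sum_congr rfl fun g _ => ?_
      rw [havg, Equiv.inv_apply]
      ring
    have hd := sum_perm_apply_apply (fun σ τ : Equiv.Perm (Fin n) => (kdist σ τ : ℝ))
      (fun σ => by simp [kdist_self]) hne
    have ht : 2 * ∑ σ : Equiv.Perm (Fin n), ∑ τ, (kdist σ τ : ℝ)
        = n.factorial * (n.factorial * ((n * (n - 1) / 2 : ℕ) : ℝ)) := by
      have : ∀ σ : Equiv.Perm (Fin n), 2 * ∑ τ, (kdist σ τ : ℝ)
          = n.factorial * ((n * (n - 1) / 2 : ℕ) : ℝ) := fun σ => by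
        exact_mod_cast two_mul_sum_kdist σ
      rw [Finset.mul_sum]
      simp only [this]
      simp [Fintype.card_perm]
    rw [Fintype.card_perm, Fintype.card_fin] at hd
    rw [hs]
    generalize ∑ g : Equiv.Perm (Equiv.Perm (Fin n)), (kdist (g σ0) (g τ0) : ℝ) = S at *
    generalize ∑ σ : Equiv.Perm (Fin n), ∑ τ, (kdist σ τ : ℝ) = T at *
    generalize (n.factorial.factorial : ℝ) = F at *
    generalize ((n * (n - 1) / 2 : ℕ) : ℝ) = M at *
    generalize (n.factorial : ℝ) = N at *
    have hN1 : N - 1 ≠ 0 := by linarith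
    have hN0 : N ≠ 0 := by linarith
    have key : 2 * (N - 1) * S = F * N * M := by
      apply mul_left_cancel₀ hN0
      linear_combination 2 * hd + F * ht
    field_simp
    linear_combination (1 - a) * key
  have hc : 1 < (n.factorial : ℝ) / ((n.factorial : ℝ) - 1) := by
    rw [one_lt_div (by linarith)]
    linarith
  have hden : 0 < (n.factorial : ℝ) / ((n.factorial : ℝ) - 1)
      * ((n * (n - 1) / 2 : ℕ) : ℝ) - 2 := by
    nlinarith
  have h4 : ∀ C M D : ℝ, (C * M * a * (1 - a) - 2 * D * a * (1 - a))
      / (C * M * a * (1 - a) - 2 * a * (1 - a)) = (C * M - 2 * D) / (C * M - 2) := by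
    intro C M D
    rw [← mul_div_mul_right (C * M - 2 * D) (C * M - 2) hq.ne']
    congr 1 <;> ring
  refine ⟨h1, h2, h3, ?_, ?_⟩
  · rw [h2.csInf_eq, h3, h1, h4]
  · rw [h2.csInf_eq, h3, h1, h4, div_left_inj' hden.ne', sub_mul, sub_right_inj,
      mul_right_inj' two_ne_zero, Nat.cast_inj]
end
end

section
/- Every arrangement p on the order-3 permutohedron can be transformed, by swapping the probabilities of at most two pairs of vertices (i.e., replacing p by p ∘ g where g ∈ Equiv.Perm (Fin 6) is the identity, a transposition, or a product of two disjoint transpositions), into an arrangement p' that has a ∧-structure and satisfies ⟨d⟩(p') ≤ ⟨d⟩(p). -/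
noncomputable section
open scoped Classical

/-- One-dimensional Abel summation bound. -/
theorem last_mul_sum_le_sum_mul : ∀ (n : ℕ) (x c : Fin (n + 1) → ℝ), Antitone x →
    (∀ k, 0 ≤ ∑ i, if i ≤ k then c i else 0) → x (Fin.last n) * ∑ i, c i ≤ ∑ i, x i * c i
  | 0, x, c, _, _ => by simp
  | n + 1, x, c, hx, hc => by
    have hc' : ∀ k : Fin (n + 1), 0 ≤ ∑ i : Fin (n + 1), if i ≤ k then c i.castSucc else 0 := by
      intro k
      have h := hc k.castSucc
      rw [Fin.sum_univ_castSucc] at h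
      simpa [Fin.castSucc_lt_last] using h
    have ih := last_mul_sum_le_sum_mul n (fun i => x i.castSucc) (fun i => c i.castSucc)
      (fun i j hij => hx (Fin.castSucc_le_castSucc_iff.2 hij)) hc'
    have hnn : 0 ≤ ∑ i : Fin (n + 1), c i.castSucc := by
      simpa [Fin.le_last] using hc' (Fin.last n)
    have hle : x (Fin.last (n + 1)) ≤ x (Fin.last n).castSucc := hx (Fin.le_last _)
    rw [Fin.sum_univ_castSucc, Fin.sum_univ_castSucc (f := fun i => x i * c i), mul_add]
    exact add_le_add_left ((mul_le_mul_of_nonneg_right hle hnn).trans ih) _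

theorem sum_mul_nonneg_of_antitone {n : ℕ} {x c : Fin (n + 1) → ℝ} (hx : Antitone x)
    (hx0 : ∀ i, 0 ≤ x i) (hc : ∀ k, 0 ≤ ∑ i, if i ≤ k then c i else 0) :
    0 ≤ ∑ i, x i * c i := by
  refine le_trans (mul_nonneg (hx0 _) ?_) (last_mul_sum_le_sum_mul n x c hx hc)
  simpa [Fin.le_last] using hc (Fin.last n)

/-- A quadratic form whose coefficient matrix has nonnegative corner sums is nonnegative on
nonnegative antitone vectors. -/
theorem sum_sum_mul_nonneg_of_antitone {n : ℕ} {x : Fin (n + 1) → ℝ}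
    {M : Fin (n + 1) → Fin (n + 1) → ℝ} (hx : Antitone x) (hx0 : ∀ i, 0 ≤ x i)
    (hM : ∀ k l, 0 ≤ ∑ i, ∑ j, if i ≤ k ∧ j ≤ l then M i j else 0) :
    0 ≤ ∑ i, ∑ j, x i * x j * M i j := by
  simp_rw [mul_assoc, ← Finset.mul_sum]
  refine sum_mul_nonneg_of_antitone hx hx0 fun k => ?_
  have hswap : (∑ i, if i ≤ k then ∑ j, x j * M i j else 0) =
      ∑ j, x j * ∑ i, if i ≤ k then M i j else 0 := by
    simp_rw [Finset.mul_sum, mul_ite, mul_zero]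
    rw [Finset.sum_comm]
    refine Finset.sum_congr rfl fun i _ => ?_
    split_ifs <;> simp
  rw [hswap]
  refine sum_mul_nonneg_of_antitone hx hx0 fun l => ?_
  refine (hM k l).trans_eq ?_
  rw [Finset.sum_comm]
  refine Finset.sum_congr rfl fun j _ => ?_
  by_cases hj : j ≤ l <;> simp [hj]

theorem dd_add_left : ∀ u i j : Fin 6, dd (u + i) (u + j) = dd i j := by
  decide +kernel

theorem avgd_eq_of_perm (f : Equiv.Perm (Fin 6)) {p w : Fin 6 → ℝ} (h : ∀ r, p (f r) = w r) :
    avgd p = ∑ r, ∑ s, w r * w s * (dd (f r) (f s) : ℝ) := by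
  unfold avgd
  rw [← Equiv.sum_comp f]
  refine Finset.sum_congr rfl fun r _ => ?_
  rw [← Equiv.sum_comp f]
  simp only [h]

/-- The sum of the swap distances between the positions `q 0, …, q k` and `q 0, …, q l`. -/
def cornerSum (q : Fin 6 → Fin 6) (k l : Fin 6) : ℕ :=
  ∑ r, if r ≤ k then ∑ s, if s ≤ l then dd (q r) (q s) else 0 else 0

theorem dd_comm (i j : Fin 6) : dd i j = dd j i :=
  min_comm _ _

theorem cornerSum_comm (q : Fin 6 → Fin 6) (k l : Fin 6) : cornerSum q k l = cornerSum q l k := by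
  simp only [cornerSum, ← Finset.sum_filter]
  rw [Finset.sum_comm]
  simp only [dd_comm]

theorem avgd_le_of_cornerSum_le {w p p' : Fin 6 → ℝ} (hw : Antitone w) (hw0 : ∀ i, 0 ≤ w i)
    (f f' : Equiv.Perm (Fin 6)) (h : ∀ r, p (f r) = w r) (h' : ∀ r, p' (f' r) = w r)
    (hc : ∀ k, ∀ l ≤ k, cornerSum f' k l ≤ cornerSum f k l) : avgd p' ≤ avgd p := by
  rw [avgd_eq_of_perm f h, avgd_eq_of_perm f' h', ← sub_nonneg]
  simp_rw [← Finset.sum_sub_distrib, ← mul_sub]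
  refine sum_sum_mul_nonneg_of_antitone hw hw0 fun k l => ?_
  have hkl : (cornerSum f' k l : ℝ) ≤ cornerSum f k l := by
    rcases le_total l k with hlk | hkl
    · exact_mod_cast hc k l hlk
    · rw [cornerSum_comm f', cornerSum_comm f]
      exact_mod_cast hc l k hkl
  refine (sub_nonneg.2 hkl).trans_eq ?_
  simp only [cornerSum, Nat.cast_sum, Nat.cast_ite, Nat.cast_zero, ← Finset.sum_sub_distrib]
  refine Finset.sum_congr rfl fun r _ => ?_
  by_cases hr : r ≤ k
  · simp only [hr, if_true, true_and, ← Finset.sum_sub_distrib]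
    refine Finset.sum_congr rfl fun s _ => ?_
    split_ifs <;> simp
  · simp [hr]

/-- Pairs of swaps `(a b)(c d)` that suffice when the largest probability sits at vertex `0`. -/
def swapList : List (Fin 6 × Fin 6 × Fin 6 × Fin 6) :=
  [(0, 0, 0, 0), (0, 1, 0, 0), (0, 2, 0, 0), (0, 3, 0, 0), (0, 4, 0, 0), (0, 5, 0, 0),
    (1, 2, 0, 0), (4, 5, 0, 0), (2, 5, 0, 0), (1, 4, 0, 0), (1, 2, 3, 5), (1, 3, 4, 5)]

/-- Composition of two swaps given by a quadruple of vertices. -/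
def swapPair (s : Fin 6 × Fin 6 × Fin 6 × Fin 6) : Equiv.Perm (Fin 6) :=
  Equiv.swap s.1 s.2.1 * Equiv.swap s.2.2.1 s.2.2.2

/-- After applying `h` to positions `q`, the two runners-up flank the leader and no corner sum
has increased. -/
abbrev Improves (h q : Fin 6 → Fin 6) : Prop :=
  ((h (q 1) + 1 = h (q 0) ∧ h (q 2) = h (q 0) + 1) ∨
    (h (q 2) + 1 = h (q 0) ∧ h (q 1) = h (q 0) + 1)) ∧
  ∀ k, ∀ l ≤ k, cornerSum (h ∘ q) k l ≤ cornerSum q k l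

theorem exists_improves_of_nodup : ∀ a b c d e : Fin 6, [0, a, b, c, d, e].Nodup →
    ∃ s ∈ swapList, Improves (swapPair s) ![0, a, b, c, d, e] := by
  decide +kernel

theorem exists_improves {q : Fin 6 → Fin 6} (hq : Function.Injective q) (h0 : q 0 = 0) :
    ∃ s ∈ swapList, Improves (swapPair s) q := by
  have hvec : q = ![0, q 1, q 2, q 3, q 4, q 5] := by
    funext i
    fin_cases i <;> simp [h0]
  have hnodup : (List.ofFn q).Nodup := List.nodup_ofFn.2 hq
  rw [hvec]
  apply exists_improves_of_nodup
  simpa [List.ofFn_succ, h0] using hnodup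

theorem swapList_disjoint : ∀ s ∈ swapList, s.2.2.1 = s.2.2.2 ∨
    (s.1 ≠ s.2.1 ∧ s.2.2.1 ≠ s.2.2.2 ∧ s.1 ≠ s.2.2.1 ∧ s.1 ≠ s.2.2.2 ∧
      s.2.1 ≠ s.2.2.1 ∧ s.2.1 ≠ s.2.2.2) := by
  decide +kernel

/-- every arrangement can be transformed, by at most two swaps
of pairs of probabilities (identity, one transposition, or a product of two
disjoint transpositions), into an arrangement with a ∧-structure and
smaller-or-equal average swap distance.  `pi` (0-indexed) enumerates the
values of `p` in nonincreasing order (which is invariant under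
rearrangement), so `pi 2 = π 3` of the paper. -/
theorem stmt_11 (p : Fin 6 → ℝ) (hp0 : ∀ i, 0 ≤ p i) (hp1 : ∑ i, p i = 1)
    (pi : Fin 6 → ℝ)
    (hpia : ∀ i j : Fin 6, i ≤ j → pi j ≤ pi i)
    (hpip : ∃ e : Equiv.Perm (Fin 6), ∀ i, pi i = p (e i)) :
    ∃ g : Equiv.Perm (Fin 6),
      (g = Equiv.refl (Fin 6) ∨ g.IsSwap ∨
        ∃ a b c e : Fin 6, a ≠ b ∧ c ≠ e ∧ a ≠ c ∧ a ≠ e ∧ b ≠ c ∧ b ≠ e ∧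
          g = Equiv.swap a b * Equiv.swap c e) ∧
      (∃ t u v : Fin 6, u = t + 1 ∧ v = u + 1 ∧
        pi 2 ≤ min (p (g t)) (min (p (g u)) (p (g v))) ∧
        p (g t) ≤ p (g u) ∧ p (g v) ≤ p (g u)) ∧
      avgd (p ∘ ⇑g) ≤ avgd p := by
  obtain ⟨e, he⟩ := hpip
  have hw0 : ∀ i, 0 ≤ pi i := fun i => by rw [he]; exact hp0 _
  have hadd : Function.Injective fun x : Fin 6 => e 0 + x := add_right_injective _
  have hq : Function.Injective fun r => e r - e 0 := fun r s h => e.injective (sub_left_injective h)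
  obtain ⟨⟨a, b, c, d⟩, hs, hpeak, hcorner⟩ := exists_improves hq (sub_self _)
  have hdisj := swapList_disjoint _ hs
  simp only [swapPair] at hpeak hcorner hdisj
  set h : Equiv.Perm (Fin 6) := Equiv.swap a b * Equiv.swap c d with hh
  set σ : Equiv.Perm (Fin 6) :=
    Equiv.swap (e 0 + a) (e 0 + b) * Equiv.swap (e 0 + c) (e 0 + d) with hσ
  have hswap : ∀ x y z, Equiv.swap (e 0 + x) (e 0 + y) (e 0 + z) = e 0 + Equiv.swap x y z :=
    fun x y z => hadd.swap_apply x y z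
  have hσh : ∀ r, σ (e r) = e 0 + h (e r - e 0) := fun r => by
    rw [hσ, hh, Equiv.Perm.mul_apply, Equiv.Perm.mul_apply, ← hswap, ← hswap, add_sub_cancel]
  have hval : ∀ r, p (σ⁻¹ (e 0 + h (e r - e 0))) = pi r := fun r => by
    simp [← hσh, he]
  refine ⟨σ⁻¹, ?_, ?_, ?_⟩
  · have hinv : σ⁻¹ = Equiv.swap (e 0 + c) (e 0 + d) * Equiv.swap (e 0 + a) (e 0 + b) := by
      simp [hσ, mul_inv_rev]
    rw [hinv]
    rcases hdisj with rfl | ⟨hab, hcd, hac, had, hbc, hbd⟩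
    · rcases eq_or_ne a b with rfl | hab
      · left
        simp only [Equiv.swap_self]
        rfl
      · right; left
        exact ⟨_, _, hadd.ne hab, by rw [Equiv.swap_self]; rfl⟩
    · right; right
      exact ⟨_, _, _, _, hadd.ne hcd, hadd.ne hab, hadd.ne hac.symm, hadd.ne hbc.symm,
        hadd.ne had.symm, hadd.ne hbd.symm, rfl⟩
  · have h01 : pi 1 ≤ pi 0 := hpia _ _ (by decide)
    have h12 : pi 2 ≤ pi 1 := hpia _ _ (by decide)
    rcases hpeak with ⟨ht, hv⟩ | ⟨ht, hv⟩
    · refine ⟨e 0 + h (e 1 - e 0), e 0 + h (e 0 - e 0), e 0 + h (e 2 - e 0), ?_, ?_, ?_⟩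
      · rw [← ht, add_assoc]
      · rw [hv, add_assoc]
      · simp only [hval, le_min_iff]
        exact ⟨⟨h12, h12.trans h01, le_rfl⟩, h01, h12.trans h01⟩
    · refine ⟨e 0 + h (e 2 - e 0), e 0 + h (e 0 - e 0), e 0 + h (e 1 - e 0), ?_, ?_, ?_⟩
      · rw [← ht, add_assoc]
      · rw [hv, add_assoc]
      · simp only [hval, le_min_iff]
        exact ⟨⟨le_rfl, h12.trans h01, h12⟩, h12.trans h01, h01⟩
  · refine avgd_le_of_cornerSum_le (fun i j => hpia i j) hw0 e (e.trans σ) (fun r => (he r).symm)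
      (fun r => by simp [he]) fun k l hlk => ?_
    have hleft : cornerSum (e.trans σ) k l = cornerSum (h ∘ fun r => e r - e 0) k l := by
      simp [cornerSum, hσh, dd_add_left]
    have hright : cornerSum e k l = cornerSum (fun r => e r - e 0) k l := by
      simp only [cornerSum]
      simp_rw [← dd_add_left (e 0) (e _ - e 0), add_sub_cancel]
    rw [hleft, hright]
    exact hcorner k l hlk
end
end

section
/- Let p be an arrangement on the order-3 permutohedron that minimizes ⟨d⟩ over all its rearrangements, i.e. ⟨d⟩(p) ≤ ⟨d⟩(p ∘ g) for every g ∈ Equiv.Perm (Fin 6). Suppose moreover that p 0 = π 1 and p 0 > π 2 (vertex 0 is the strict unique maximum). Then either p 0 ≥ p 1 ≥ p 5 ≥ p 2 ≥ p 4 ≥ p 3, or p 0 ≥ p 5 ≥ p 1 ≥ p 4 ≥ p 2 ≥ p 3. -/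
noncomputable section
open scoped Classical

/-- The average swap distance as a sum over unordered pairs of vertices. -/
lemma avgd_eq (p : Fin 6 → ℝ) :
    avgd p = 2 * (p 0 * p 1 + p 1 * p 2 + p 2 * p 3 + p 3 * p 4 + p 4 * p 5 + p 5 * p 0)
      + 4 * (p 0 * p 2 + p 1 * p 3 + p 2 * p 4 + p 3 * p 5 + p 4 * p 0 + p 5 * p 1)
      + 6 * (p 0 * p 3 + p 1 * p 4 + p 2 * p 5) := by
  norm_num [avgd, Fin.sum_univ_six, dd]
  ring

lemma nonneg_of_flips {a b c : ℝ} (ha : 0 < a) (hb : 0 ≤ b * (a + c))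
    (hc : 0 ≤ c * (a + b)) (hbc : 0 ≤ a * (b + c)) : 0 ≤ b ∧ 0 ≤ c := by
  have hsum : 0 ≤ b + c := nonneg_of_mul_nonneg_right hbc ha
  constructor
  · by_contra! h
    nlinarith
  · by_contra! h
    nlinarith

/-- A strict first entry of a nonincreasing enumeration exceeds every other value. -/
lemma lt_of_sorted {p q : Fin 6 → ℝ} (hq : ∀ i j : Fin 6, i ≤ j → q j ≤ q i)
    (hperm : ∃ e : Equiv.Perm (Fin 6), ∀ i, q i = p (e i)) (hstrict : q 1 < p 0)
    {i : Fin 6} (hi : i ≠ 0) : p i < p 0 := by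
  obtain ⟨e, he⟩ := hperm
  have key : ∀ j, e.symm j ≠ 0 → p j < p 0 := fun j hj => by
    have h := hq 1 (e.symm j) (Fin.one_le_of_ne_zero hj)
    rw [he (e.symm j), e.apply_symm_apply] at h
    exact h.trans_lt hstrict
  have h0 : e.symm 0 = 0 := by
    by_contra h
    exact lt_irrefl _ (key 0 h)
  refine key i fun h => hi (e.symm.injective (h.trans h0.symm))

/-- Polarization: the three edge reflections of the hexagon compare each vertex near `0`
with its mirror image. -/
lemma polarized_of_min {p : Fin 6 → ℝ} (hmin : ∀ g : Equiv.Perm (Fin 6), avgd p ≤ avgd (p ∘ ⇑g))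
    (h3 : p 3 < p 0) (h1 : p 1 < p 0) (h5 : p 5 < p 0) :
    (p 4 ≤ p 1 ∧ p 3 ≤ p 2) ∧ (p 2 ≤ p 1 ∧ p 4 ≤ p 5) ∧ (p 2 ≤ p 5 ∧ p 3 ≤ p 4) := by
  have two (i j k l : Fin 6) := hmin (Equiv.swap i j * Equiv.swap k l)
  have one (i j : Fin 6) := hmin (Equiv.swap i j)
  simp only [avgd_eq, Function.comp_apply, Equiv.Perm.mul_apply] at one two
  have a1 := one 1 4
  have a2 := one 2 3
  have a3 := two 1 4 2 3
  have b1 := one 1 2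
  have b2 := one 5 4
  have b3 := two 1 2 5 4
  have c1 := one 5 2
  have c2 := one 4 3
  have c3 := two 5 2 4 3
  simp [Equiv.swap_apply_def] at a1 a2 a3 b1 b2 b3 c1 c2 c3
  have a := nonneg_of_flips (a := p 0 - p 5) (b := p 1 - p 4) (c := p 2 - p 3)
    (by linarith) (by linarith) (by linarith) (by linarith)
  have b := nonneg_of_flips (a := p 0 - p 3) (b := p 1 - p 2) (c := p 5 - p 4)
    (by linarith) (by linarith) (by linarith) (by linarith)
  have c := nonneg_of_flips (a := p 0 - p 1) (b := p 5 - p 2) (c := p 4 - p 3)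
    (by linarith) (by linarith) (by linarith) (by linarith)
  simpa only [sub_nonneg] using And.intro a (And.intro b c)

/-- Reflecting only one of the two pairs exchanged by the reflection through `0` and `3`
does not lower the average swap distance of a minimizer. -/
lemma mul_nonneg_of_min {p : Fin 6 → ℝ}
    (hmin : ∀ g : Equiv.Perm (Fin 6), avgd p ≤ avgd (p ∘ ⇑g)) :
    0 ≤ (p 1 - p 5) * (p 2 - p 4) := by
  have h := hmin (Equiv.swap 1 5)
  simp only [avgd_eq, Function.comp_apply] at h
  simp [Equiv.swap_apply_def] at h
  linarith

/-- structure of minimum-⟨d⟩ arrangements whose unique maximum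
sits at vertex 0.  `pi` (0-indexed) enumerates the values of `p` in
nonincreasing order, so `pi 0 = π 1` and `pi 1 = π 2` of the paper. -/
theorem stmt_12 (p : Fin 6 → ℝ) (hp0 : ∀ i, 0 ≤ p i) (hp1 : ∑ i, p i = 1)
    (pi : Fin 6 → ℝ)
    (hpia : ∀ i j : Fin 6, i ≤ j → pi j ≤ pi i)
    (hpip : ∃ e : Equiv.Perm (Fin 6), ∀ i, pi i = p (e i))
    (hmin : ∀ g : Equiv.Perm (Fin 6), avgd p ≤ avgd (p ∘ ⇑g))
    (hmax : p 0 = pi 0) (hstrict : pi 1 < p 0) :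
    (p 1 ≤ p 0 ∧ p 5 ≤ p 1 ∧ p 2 ≤ p 5 ∧ p 4 ≤ p 2 ∧ p 3 ≤ p 4) ∨
    (p 5 ≤ p 0 ∧ p 1 ≤ p 5 ∧ p 4 ≤ p 1 ∧ p 2 ≤ p 4 ∧ p 3 ≤ p 2) := by
  have hlt {i : Fin 6} (hi : i ≠ 0) : p i < p 0 := lt_of_sorted hpia hpip hstrict hi
  have h1 := hlt (i := 1) (by decide)
  have h5 := hlt (i := 5) (by decide)
  obtain ⟨⟨h41, h32⟩, ⟨h21, h45⟩, ⟨h25, h34⟩⟩ :=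
    polarized_of_min hmin (hlt (by decide)) h1 h5
  rcases mul_nonneg_iff.mp (mul_nonneg_of_min hmin) with ⟨h, h'⟩ | ⟨h, h'⟩
  · exact Or.inl ⟨h1.le, sub_nonneg.mp h, h25, sub_nonneg.mp h', h34⟩
  · exact Or.inr ⟨h5.le, sub_nonpos.mp h, h41, sub_nonpos.mp h', h32⟩
end
end

section
/- For every arrangement p on the order-3 permutohedron, the minimum of ⟨d⟩(p ∘ g) over all g ∈ Equiv.Perm (Fin 6) equals 3*S̄(p) - 2*(π 1*(2*π 2 + π 4) + π 2*(2*π 4 + π 6) + π 3*(2*π 1 + π 2) + π 4*(2*π 6 + π 5) + π 5*(2*π 3 + π 1) + π 6*(2*π 5 + π 3)). -/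
noncomputable section
open scoped Classical

/-- If all prefix sums of `c` are nonnegative, then `∑ i, a i * c i` is nonnegative for every
nonnegative antitone `a`. -/
lemma sum_mul_nonneg_of_antitone_s13 {n : ℕ} {a c : Fin n → ℝ} (ha : Antitone a)
    (ha0 : ∀ i, 0 ≤ a i) (hc : ∀ m, 0 ≤ ∑ i ∈ Finset.Iic m, c i) : 0 ≤ ∑ i, a i * c i := by
  cases n with
  | zero => simp
  | succ n =>
    have key : a (Fin.last n) * ∑ i, c i ≤ ∑ i, a i * c i := by
      induction n with
      | zero => simp
      | succ n ih =>
        have hprefix (m : Fin (n + 1)) :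
            ∑ i ∈ Finset.Iic m, c i.castSucc = ∑ i ∈ Finset.Iic m.castSucc, c i := by
          rw [← Fin.map_castSuccEmb_Iic, Finset.sum_map]
          rfl
        have h := ih (a := fun i => a i.castSucc) (c := fun i => c i.castSucc)
          (fun i j hij => ha (Fin.castSucc_le_castSucc_iff.2 hij)) (fun i => ha0 _)
          (fun m => by rw [hprefix]; exact hc _)
        have hsum : 0 ≤ ∑ i : Fin (n + 1), c i.castSucc := by
          have h' := hc (Fin.last n).castSucc
          rw [← hprefix, ← Fin.top_eq_last, Finset.Iic_top] at h'
          exact h'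
        have hlast : a (Fin.last (n + 1)) ≤ a (Fin.last n).castSucc := ha (Fin.le_last _)
        rw [Fin.sum_univ_castSucc, Fin.sum_univ_castSucc (fun i => a i * c i), mul_add]
        have h2 := mul_le_mul_of_nonneg_right hlast hsum
        linarith
    refine le_trans (mul_nonneg (ha0 _) ?_) key
    have h := hc (Fin.last n)
    rwa [← Fin.top_eq_last, Finset.Iic_top] at h

/-- A quadratic form is monotone, on nonnegative antitone vectors, with respect to the
rectangular prefix sums of its coefficients. -/
lemma sum_sum_mul_le_of_antitone {n : ℕ} {a : Fin n → ℝ} (ha : Antitone a) (ha0 : ∀ i, 0 ≤ a i)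
    {A B : Fin n → Fin n → ℝ}
    (h : ∀ k l, ∑ i ∈ Finset.Iic k, ∑ j ∈ Finset.Iic l, A i j ≤
      ∑ i ∈ Finset.Iic k, ∑ j ∈ Finset.Iic l, B i j) :
    ∑ i, ∑ j, a i * a j * A i j ≤ ∑ i, ∑ j, a i * a j * B i j := by
  have key : 0 ≤ ∑ i, a i * ∑ j, a j * (B i j - A i j) := by
    refine sum_mul_nonneg_of_antitone_s13 ha ha0 fun k => ?_
    rw [Finset.sum_comm]
    simp_rw [← Finset.mul_sum]
    refine sum_mul_nonneg_of_antitone_s13 ha ha0 fun l => ?_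
    rw [Finset.sum_comm]
    simpa only [Finset.sum_sub_distrib, sub_nonneg] using h k l
  rw [← sub_nonneg]
  convert key using 1
  simp only [← Finset.sum_sub_distrib, Finset.mul_sum]
  exact Finset.sum_congr rfl fun i _ => Finset.sum_congr rfl fun j _ => by ring

/-- The organ-pipe arrangement: the entry at position `i` of the cycle is the `organPipe i`-th
largest one (counting from `0`). -/
def organPipe : Equiv.Perm (Fin 6) where
  toFun := ![0, 1, 3, 5, 4, 2]
  invFun := ![0, 1, 5, 2, 4, 3]
  left_inv := by decide
  right_inv := by decide

/-- A Riesz rearrangement inequality on the 6-cycle: among pairs of sets with prescribed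
cardinalities, concentric arcs minimize the total swap distance. -/
lemma sum_dd_organPipe_le :
    ∀ k, ∀ S ∈ Finset.powersetCard (k.val + 1) (Finset.univ : Finset (Fin 6)),
    ∀ l, ∀ T ∈ Finset.powersetCard (l.val + 1) (Finset.univ : Finset (Fin 6)),
    ∑ i ∈ Finset.Iic k, ∑ j ∈ Finset.Iic l, dd (organPipe.symm i) (organPipe.symm j) ≤
      ∑ i ∈ S, ∑ j ∈ T, dd i j := by
  decide +kernel

lemma avgd_comp_perm (a : Fin 6 → ℝ) (σ : Equiv.Perm (Fin 6)) :
    avgd (a ∘ σ) = ∑ i, ∑ j, a i * a j * (dd (σ.symm i) (σ.symm j) : ℝ) := by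
  rw [avgd, ← Equiv.sum_comp σ.symm]
  refine Finset.sum_congr rfl fun i _ => ?_
  rw [← Equiv.sum_comp σ.symm]
  simp

lemma avgd_organPipe_le {a : Fin 6 → ℝ} (ha : Antitone a) (ha0 : ∀ i, 0 ≤ a i)
    (σ : Equiv.Perm (Fin 6)) : avgd (a ∘ organPipe) ≤ avgd (a ∘ σ) := by
  rw [avgd_comp_perm, avgd_comp_perm]
  refine sum_sum_mul_le_of_antitone ha ha0 fun k l => ?_
  have h := sum_dd_organPipe_le k ((Finset.Iic k).map σ.symm.toEmbedding)
    (by simp [Finset.mem_powersetCard]) l ((Finset.Iic l).map σ.symm.toEmbedding)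
    (by simp [Finset.mem_powersetCard])
  simp only [Finset.sum_map, Equiv.coe_toEmbedding] at h
  exact_mod_cast h

lemma avgd_comp_organPipe (a : Fin 6 → ℝ) :
    avgd (a ∘ organPipe) = 3 * ((∑ i, a i) ^ 2 - Simpson a) - 2 *
      (a 0 * (2 * a 1 + a 3) + a 1 * (2 * a 3 + a 5) +
       a 2 * (2 * a 0 + a 1) + a 3 * (2 * a 5 + a 4) +
       a 4 * (2 * a 2 + a 0) + a 5 * (2 * a 4 + a 2)) := by
  simp [avgd, Simpson, Fin.sum_univ_six, dd, organPipe]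
  norm_num [min_def]
  ring

/-- closed formula for the minimum of `⟨d⟩(p ∘ g)` over all
permutations `g`.  `pi` (0-indexed) enumerates the values of `p` in
nonincreasing order, so `pi 0 = π 1`, …, `pi 5 = π 6` of the paper. -/
theorem stmt_13 (p : Fin 6 → ℝ) (hp0 : ∀ i, 0 ≤ p i) (hp1 : ∑ i, p i = 1)
    (pi : Fin 6 → ℝ)
    (hpia : ∀ i j : Fin 6, i ≤ j → pi j ≤ pi i)
    (hpip : ∃ e : Equiv.Perm (Fin 6), ∀ i, pi i = p (e i)) :
    IsLeast {x : ℝ | ∃ g : Equiv.Perm (Fin 6), x = avgd (p ∘ ⇑g)}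
      (3 * (1 - Simpson p) - 2 *
        (pi 0 * (2 * pi 1 + pi 3) + pi 1 * (2 * pi 3 + pi 5) +
         pi 2 * (2 * pi 0 + pi 1) + pi 3 * (2 * pi 5 + pi 4) +
         pi 4 * (2 * pi 2 + pi 0) + pi 5 * (2 * pi 4 + pi 2))) := by
  obtain ⟨e, he⟩ := hpip
  obtain rfl : pi = p ∘ e := funext he
  have hS : Simpson p = Simpson (p ∘ e) := (Equiv.sum_comp e fun i => p i ^ 2).symm
  have h1 : ∑ i, (p ∘ e) i = 1 := (Equiv.sum_comp e p).trans hp1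
  have hval := avgd_comp_organPipe (p ∘ e)
  rw [h1, one_pow, ← hS] at hval
  rw [← hval]
  refine ⟨⟨organPipe.trans e, rfl⟩, ?_⟩
  rintro _ ⟨g, rfl⟩
  have h := avgd_organPipe_le (fun i j => hpia i j) (fun i => hp0 (e i)) (g.trans e.symm)
  have hg : (p ∘ e) ∘ (g.trans e.symm) = p ∘ g := by
    ext i
    simp
  rwa [hg] at h
end
end
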